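/- arXiv:1107.2327 — 2 statements merged into one kernel-verified Lean document; each statement's English description precedes it below -/
import Mathlib

section
/- Let λ, p be nonzero real numbers, let k, l be integers with 0 ≤ k < l, and let 𝔞 be a real polynomial with derivative 𝔞'. For m ∈ {k, l} define E_m = (l−k)² · λ^{2(l−k−1)} · (λ^m · 𝔞'(λ) − m · λ^{m−1} · 𝔞(λ)) / (2 p²), where all powers of λ are integer powers (zpow), and define g = −2 (k−l)² · λ^{2l−k−2} / p. Then (E_l − λ^{l−k} · E_k) / (3 g²) = λ^{1−l} · 𝔞(λ) / (24 (k−l)). -/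
/-- The algebraic identity behind the computation of the central invariants of
the bi-Hamiltonian pair `(P_k, P_l)` of the `r`-KdV-CH hierarchy:
`c = (E_l − λ^{l−k} E_k)/(3 g²) = λ^{1−l} 𝔞(λ)/(24(k−l))`. -/
theorem rKdVCH_central_invariant (lam p : ℝ) (hlam : lam ≠ 0) (hp : p ≠ 0)
    (k l : ℤ) (hk : 0 ≤ k) (hkl : k < l) (A : Polynomial ℝ) (E : ℤ → ℝ)
    (hE : ∀ m : ℤ, m = k ∨ m = l →
      E m = ((l - k : ℤ) : ℝ) ^ 2 * lam ^ (2 * (l - k - 1))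
        * (lam ^ m * (Polynomial.derivative A).eval lam
            - (m : ℝ) * lam ^ (m - 1) * A.eval lam) / (2 * p ^ 2))
    (g : ℝ) (hg : g = -2 * ((k - l : ℤ) : ℝ) ^ 2 * lam ^ (2 * l - k - 2) / p) :
    (E l - lam ^ (l - k) * E k) / (3 * g ^ 2)
      = lam ^ (1 - l) * A.eval lam / (24 * ((k - l : ℤ) : ℝ)) := by
  have hd : (k : ℝ) - l ≠ 0 := by
    have : (k : ℝ) < l := by exact_mod_cast hkl
    exact (sub_neg.mpr this).ne
  have hx : lam ^ k ≠ 0 := zpow_ne_zero _ hlam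
  have hy : lam ^ l ≠ 0 := zpow_ne_zero _ hlam
  have e1 : lam ^ (2 * (l - k - 1)) = (lam ^ l / lam ^ k / lam) ^ 2 := by
    rw [mul_comm, zpow_mul, zpow_sub₀ hlam, zpow_sub₀ hlam, zpow_one]
    norm_cast
  have e2 : lam ^ (2 * l - k - 2) = (lam ^ l) ^ 2 / lam ^ k / lam ^ 2 := by
    rw [zpow_sub₀ hlam, zpow_sub₀ hlam, mul_comm, zpow_mul]
    norm_cast
  rw [hE l (Or.inr rfl), hE k (Or.inl rfl), hg, e1, e2, zpow_sub₀ hlam l k,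
    zpow_sub₀ hlam 1 l, zpow_sub₀ hlam l 1, zpow_sub₀ hlam k 1, zpow_one]
  push_cast
  generalize lam ^ k = x at *
  generalize lam ^ l = y at *
  generalize (Polynomial.derivative A).eval lam = b
  generalize A.eval lam = a
  have hl : (l : ℝ) = k - (k - l) := by ring
  generalize (k : ℝ) - l = d at *
  rw [hl]
  generalize (k : ℝ) = c
  have h2 : c - d - c = -d := by ring
  rw [h2]
  field_simp
  ring
end

section
/- Let σ be a finite type, let K ∈ MvPolynomial σ ℝ, and let C ∈ ℝ be such that (n : ℝ) + C ≠ 0 for every natural number n for which the homogeneous component of K of degree n is nonzero. Then there exists K̃ ∈ MvPolynomial σ ℝ such that Σ_{i ∈ σ} X_i · pderiv i K̃ + C • K̃ = K, where pderiv i denotes the partial derivative with respect to the variable X_i. -/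
open MvPolynomial

/-- Solvability of the quasilinear equation `Lie_E K̃ + C K̃ = K` (equation
(47) of the paper), where `Lie_E` acts on polynomial densities as the Euler
operator `Σ_i X_i ∂/∂X_i`: provided `n + C ≠ 0` for every degree `n` occurring
in `K`, a solution `K̃` exists. -/
theorem euler_equation_solvable (σ : Type*) [Fintype σ] (K : MvPolynomial σ ℝ)
    (C : ℝ) (hC : ∀ n : ℕ, homogeneousComponent n K ≠ 0 → (n : ℝ) + C ≠ 0) :
    ∃ Kt : MvPolynomial σ ℝ,
      ∑ i : σ, X i * pderiv i Kt + C • Kt = K := by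
  refine ⟨∑ n ∈ Finset.range (K.totalDegree + 1),
    ((n : ℝ) + C)⁻¹ • homogeneousComponent n K, ?_⟩
  conv_rhs => rw [← sum_homogeneousComponent K]
  simp only [map_sum, Finset.mul_sum, Finset.smul_sum]
  rw [Finset.sum_comm, ← Finset.sum_add_distrib]
  refine Finset.sum_congr rfl fun n _ => ?_
  have h := (homogeneousComponent_isHomogeneous n K).sum_X_mul_pderiv
  simp only [Derivation.map_smul, mul_smul_comm, ← Finset.smul_sum]
  rw [h, ← Nat.cast_smul_eq_nsmul ℝ, smul_comm C, ← smul_add, ← add_smul]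
  by_cases h0 : homogeneousComponent n K = 0
  · simp [h0]
  · rw [smul_smul, inv_mul_cancel₀ (hC n h0), one_smul]
end
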